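/- arXiv:1808.00453 — 2 statements merged into one kernel-verified Lean document; each statement's English description precedes it below -/
import Mathlib

section
/- For every integer k ≥ 5 there exists a constant c' > 0 (depending only on k) such that for every integer n ≥ k, every k-uniform hypergraph on at least 2^(2^(2^(c'·n^(k−4)·log n))) vertices with the property that every set of k+1 vertices induces exactly 0, 2, or 4 edges contains an independent set of size n. Equivalently, g_k(n) ≤ 2^(2^(2^(c'·n^(k−4)·log n))). -/
open Finset in
theorem exists_end_homogeneous_aux {α : Type*} [LinearOrder α] (P : Finset α → Prop)
    (s m j : ℕ) (B A : Finset α) (hcard : #B + j = m) (hBA : ∀ b ∈ B, ∀ a ∈ A, b < a)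
    (hom : ∀ S ⊆ B, #S = s + 1 → ∀ x ∈ B ∪ A, ∀ y ∈ B ∪ A, (∀ a ∈ S, a < x) →
      (∀ a ∈ S, a < y) → (P (insert x S) ↔ P (insert y S)))
    (hA : (2 * 2 ^ m ^ s) ^ j ≤ #A) :
    ∃ C z, C ⊆ B ∪ A ∧ z ∈ B ∪ A ∧ #C = m ∧ (∀ c ∈ C, c < z) ∧
      ∀ S ⊆ C, #S = s + 1 → ∀ x ∈ C, (∀ a ∈ S, a < x) →
        (P (insert x S) ↔ P (insert z S)) := by
  classical
  induction j generalizing B A with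
  | zero =>
    obtain ⟨z, hz⟩ : A.Nonempty := card_pos.1 (by simpa using hA)
    refine ⟨B, z, subset_union_left, mem_union_right _ hz, by simpa using hcard,
      fun b hb => hBA b hb z hz, fun S hS hc x hx hlt => ?_⟩
    exact hom S hS hc x (mem_union_left _ hx) z (mem_union_right _ hz) hlt
      fun a ha => hBA a (hS ha) z hz
  | succ j ih =>
    set q := 2 ^ m ^ s with hq
    have hq1 : 1 ≤ q := Nat.one_le_two_pow
    have hR : 1 ≤ (2 * q) ^ j := Nat.one_le_pow _ _ (by omega)
    have hA' : q * (2 * q) ^ j + 1 ≤ #A := by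
      refine le_trans ?_ hA
      have : 1 ≤ q * (2 * q) ^ j := Nat.mul_pos hq1 hR
      rw [pow_succ]
      nlinarith
    have hAne : A.Nonempty := card_pos.1 (by omega)
    set v := A.min' hAne with hv
    have hvA : v ∈ A := min'_mem _ _
    have hvlt : ∀ a ∈ A.erase v, v < a := fun a ha =>
      lt_of_le_of_ne (min'_le _ _ (mem_of_mem_erase ha)) (ne_of_mem_erase ha).symm
    have hcolors : #(powersetCard s B).powerset ≤ q := by
      rw [card_powerset, card_powersetCard]
      exact Nat.pow_le_pow_right two_pos
        ((Nat.choose_le_pow _ _).trans (Nat.pow_le_pow_left (by omega) _))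
    obtain ⟨F, -, hF⟩ := exists_le_card_fiber_of_mul_le_card_of_maps_to
      (s := A.erase v) (t := (powersetCard s B).powerset) (n := (2 * q) ^ j)
      (f := fun x => {T ∈ powersetCard s B | P (insert x (insert v T))})
      (fun x _ => mem_powerset.2 (filter_subset _ _)) ⟨∅, by simp⟩
      (by
        rw [card_erase_of_mem hvA]
        exact (Nat.mul_le_mul_right _ hcolors).trans (by omega))
    set A₂ := {x ∈ A.erase v | {T ∈ powersetCard s B | P (insert x (insert v T))} = F} with hA₂
    have hA₂A : A₂ ⊆ A.erase v := filter_subset _ _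
    have hvB : v ∉ B := fun h => lt_irrefl _ (hBA v h v hvA)
    have hsub : insert v B ∪ A₂ ⊆ B ∪ A := by
      intro x hx
      have := @hA₂A x
      simp only [mem_union, mem_insert, mem_erase] at hx this ⊢
      grind
    have habove : ∀ x ∈ insert v B ∪ A₂, v < x → x ∈ A₂ := by
      intro x hx hvx
      simp only [mem_union, mem_insert] at hx
      rcases hx with (rfl | hx) | hx
      · exact absurd hvx (lt_irrefl _)
      · exact absurd hvx (hBA x hx v hvA).not_gt
      · exact hx
    obtain ⟨C, z, hC, hz, h⟩ := ih (insert v B) A₂ (by rw [card_insert_of_notMem hvB]; omega)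
      (by
        intro b hb a ha
        rcases mem_insert.1 hb with rfl | hb
        · exact hvlt a (hA₂A ha)
        · exact hBA b hb a (mem_of_mem_erase (hA₂A ha)))
      (by
        intro S hS hc x hx y hy hltx hlty
        by_cases hvS : v ∈ S
        · have hx₂ := habove x hx (hltx v hvS)
          have hy₂ := habove y hy (hlty v hvS)
          have hT : S.erase v ∈ powersetCard s B := by
            rw [mem_powersetCard, card_erase_of_mem hvS, hc]
            exact ⟨by rwa [← subset_insert_iff], rfl⟩
          have e := (mem_filter.1 hx₂).2.trans (mem_filter.1 hy₂).2.symm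
          have := Finset.ext_iff.1 e (S.erase v)
          simpa [hT, insert_erase hvS, -mem_powersetCard] using this
        · exact hom S ((subset_insert_iff_of_notMem hvS).1 hS) hc x (hsub hx) y (hsub hy)
            hltx hlty)
      hF
    exact ⟨C, z, hC.trans hsub, hsub hz, h⟩

open Finset in
/-- The Erdős–Rado argument: in a large ordered set one finds `C` and a vertex `z` above it
such that whether `P` holds for an `(s + 2)`-subset of `C` depends on its first `s + 1`
elements only. -/
theorem exists_end_homogeneous {α : Type*} [LinearOrder α] (P : Finset α → Prop)
    (s m : ℕ) (A : Finset α) (hA : (2 * 2 ^ m ^ s) ^ m ≤ #A) :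
    ∃ C z, C ⊆ A ∧ z ∈ A ∧ #C = m ∧ (∀ c ∈ C, c < z) ∧
      ∀ S ⊆ C, #S = s + 1 → ∀ x ∈ C, (∀ a ∈ S, a < x) →
        (P (insert x S) ↔ P (insert z S)) := by
  have h := exists_end_homogeneous_aux P s m m ∅ A (by simp) (by simp)
    (by
      intro S hS hc
      simp [subset_empty.1 hS] at hc) hA
  rwa [empty_union] at h

open Finset in
theorem forall_not_of_end_homogeneous {α : Type*} [LinearOrder α] {P : Finset α → Prop}
    {s : ℕ} {C I : Finset α} {z : α} (hIC : I ⊆ C)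
    (hom : ∀ S ⊆ C, #S = s → ∀ x ∈ C, (∀ a ∈ S, a < x) → (P (insert x S) ↔ P (insert z S)))
    (hI : ∀ S ⊆ I, #S = s → ¬ P (insert z S)) :
    ∀ S ⊆ I, #S = s + 1 → ¬ P S := by
  classical
  intro S hS hc
  have hne : S.Nonempty := card_pos.1 (by omega)
  have hm : S.max' hne ∈ S := max'_mem _ _
  have hsub : S.erase (S.max' hne) ⊆ I := (erase_subset _ _).trans hS
  have hc' : #(S.erase (S.max' hne)) = s := by rw [card_erase_of_mem hm]; omega
  have h := hom _ (hsub.trans hIC) hc' _ (hIC (hS hm)) fun a ha => lt_max'_of_mem_erase_max' _ _ ha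
  rw [insert_erase hm] at h
  rw [h]
  exact hI _ hsub hc'

open Finset in
theorem exists_independent_aux {α : Type*} [LinearOrder α] (Q : Finset α → Prop)
    (t n j : ℕ) (D I A : Finset α) (F : Finset (Finset α)) (hID : I ⊆ D) (hAD : A ⊆ D)
    (hQ : ∀ T ⊆ D, #T = t → ∀ v ∈ D, ∀ w ∈ D, ∀ a ∈ D, (∀ x ∈ T, x < v) → v < w → w < a →
      Q (insert w (insert v T)) → Q (insert a (insert v T)) → ¬ Q (insert a (insert w T)))
    (hIn : #I ≤ n) (hF : F ⊆ powersetCard t I) (hIA : ∀ b ∈ I, ∀ a ∈ A, b < a)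
    (hind : ∀ S ⊆ I, #S = t + 2 → ¬ Q S)
    (hlink : ∀ S ⊆ I, #S = t + 1 → ∀ a ∈ A, ¬ Q (insert a S))
    (hfin : ∀ T ∈ F, ∀ w ∈ A, ∀ a ∈ A, w < a → ¬ Q (insert a (insert w T)))
    (hj : n + n ^ t ≤ #I + #F + j) (hA : (n ^ t + 2) ^ j ≤ #A) :
    ∃ J ⊆ D, #J = n ∧ ∀ S ⊆ J, #S = t + 2 → ¬ Q S := by
  classical
  induction j generalizing I A F with
  | zero =>
    have h1 : #F ≤ n ^ t := (card_le_card hF).trans <| by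
      rw [card_powersetCard]
      exact (Nat.choose_le_pow _ _).trans (Nat.pow_le_pow_left hIn _)
    exact ⟨I, hID, by omega, hind⟩
  | succ j ih =>
    rcases hIn.eq_or_lt with hIn | hIn
    · exact ⟨I, hID, hIn, hind⟩
    set p := n ^ t with hp
    have hp' : #(powersetCard t I) ≤ p := by
      rw [card_powersetCard]
      exact (Nat.choose_le_pow _ _).trans (Nat.pow_le_pow_left hIn.le _)
    set R := (p + 2) ^ j with hR
    have hR1 : 1 ≤ R := Nat.one_le_pow _ _ (by omega)
    have hA' : R * (p + 2) ≤ #A := by rwa [pow_succ] at hA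
    have hAne : A.Nonempty := card_pos.1 (by nlinarith)
    set v := A.min' hAne with hv
    have hvA : v ∈ A := min'_mem _ _
    have hvlt : ∀ a ∈ A.erase v, v < a := fun a ha =>
      lt_of_le_of_ne (min'_le _ _ (mem_of_mem_erase ha)) (ne_of_mem_erase ha).symm
    have hvI : v ∉ I := fun h => lt_irrefl _ (hIA v h v hvA)
    by_cases hT : ∃ T ∈ powersetCard t I, T ∉ F ∧
        R ≤ #{a ∈ A.erase v | Q (insert a (insert v T))}
    · obtain ⟨T, hTI, hTF, hTR⟩ := hT
      set A₂ := {a ∈ A.erase v | Q (insert a (insert v T))} with hA₂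
      have hA₂e : A₂ ⊆ A.erase v := filter_subset _ _
      have hA₂A : A₂ ⊆ A := hA₂e.trans (erase_subset _ _)
      obtain ⟨hTI', hTc⟩ := mem_powersetCard.1 hTI
      refine ih I A₂ (insert T F) hID (hA₂A.trans hAD) hIn.le
        (insert_subset hTI hF) (fun b hb a ha => hIA b hb a (hA₂A ha)) hind
        (fun S hS hc a ha => hlink S hS hc a (hA₂A ha)) ?_
        (by rw [card_insert_of_notMem hTF]; omega) hTR
      intro T' hT' w hw a ha hwa
      rcases mem_insert.1 hT' with rfl | hT'
      · exact hQ _ (hTI'.trans hID) hTc v (hAD hvA) w (hAD (hA₂A hw)) a (hAD (hA₂A ha))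
          (fun x hx => hIA x (hTI' hx) v hvA) (hvlt w (hA₂e hw)) hwa (mem_filter.1 hw).2
          (mem_filter.1 ha).2
      · exact hfin T' hT' w (hA₂A hw) a (hA₂A ha) hwa
    · push Not at hT
      set bad := (powersetCard t I).biUnion
        fun T => {a ∈ A.erase v | Q (insert a (insert v T))} with hbad
      have hbadc : #bad ≤ p * R := by
        refine (card_biUnion_le_card_mul _ _ R fun T hTI => ?_).trans
          (Nat.mul_le_mul_right _ hp')
        by_cases hTF : T ∈ F
        · rw [filter_false_of_mem fun a ha =>
            hfin T hTF v hvA a (mem_of_mem_erase ha) (hvlt a ha)]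
          simp
        · exact (hT T hTI hTF).le
      set A₂ := A.erase v \ bad with hA₂
      have hA₂e : A₂ ⊆ A.erase v := sdiff_subset
      have hA₂A : A₂ ⊆ A := hA₂e.trans (erase_subset _ _)
      have hA₂c : R ≤ #A₂ := by
        have h1 := le_card_sdiff bad (A.erase v)
        rw [card_erase_of_mem hvA, ← hA₂] at h1
        have h2 : R * (p + 2) = p * R + 2 * R := by ring
        omega
      refine ih (insert v I) A₂ F (insert_subset (hAD hvA) hID) (hA₂A.trans hAD)
        (by rw [card_insert_of_notMem hvI]; omega)
        (hF.trans (powersetCard_mono (subset_insert _ _))) ?_ ?_ ?_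
        (fun T hT w hw a ha => hfin T hT w (hA₂A hw) a (hA₂A ha))
        (by rw [card_insert_of_notMem hvI]; omega) hA₂c
      · intro b hb a ha
        rcases mem_insert.1 hb with rfl | hb
        · exact hvlt a (hA₂e ha)
        · exact hIA b hb a (hA₂A ha)
      · intro S hS hc
        by_cases hvS : v ∈ S
        · have := hlink (S.erase v) (by rwa [← subset_insert_iff])
            (by rw [card_erase_of_mem hvS]; omega) v hvA
          rwa [insert_erase hvS] at this
        · exact hind S ((subset_insert_iff_of_notMem hvS).1 hS) hc
      · intro S hS hc a ha
        by_cases hvS : v ∈ S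
        · intro hQa
          refine (mem_sdiff.1 ha).2 (mem_biUnion.2 ⟨S.erase v, mem_powersetCard.2
            ⟨by rwa [← subset_insert_iff], by rw [card_erase_of_mem hvS]; omega⟩,
            mem_filter.2 ⟨hA₂e ha, ?_⟩⟩)
          rwa [insert_erase hvS]
        · exact hlink S ((subset_insert_iff_of_notMem hvS).1 hS) hc a (hA₂A ha)

open Finset in
/-- An online Ramsey argument for ordered `(t + 2)`-graphs in which no `(t + 3)`-set
`T < v < w < a` contains all three edges obtained by deleting `a`, `w` or `v`. -/
theorem exists_independent {α : Type*} [LinearOrder α] (Q : Finset α → Prop)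
    (t n : ℕ) (D : Finset α)
    (hQ : ∀ T ⊆ D, #T = t → ∀ v ∈ D, ∀ w ∈ D, ∀ a ∈ D, (∀ x ∈ T, x < v) → v < w → w < a →
      Q (insert w (insert v T)) → Q (insert a (insert v T)) → ¬ Q (insert a (insert w T)))
    (hD : (n ^ t + 2) ^ (n + n ^ t) ≤ #D) :
    ∃ J ⊆ D, #J = n ∧ ∀ S ⊆ J, #S = t + 2 → ¬ Q S := by
  refine exists_independent_aux Q t n (n + n ^ t) D ∅ D ∅ (by simp) subset_rfl hQ (by simp)
    (by simp) (by simp) ?_ ?_ (by simp) (by simp) hD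
  all_goals
    intro S hS hc
    simp [subset_empty.1 hS] at hc

open Finset in
/-- If every `(t + 6)`-set induces neither exactly one nor at least five edges, the link of a
vertex `u` yields a large independent set. -/
theorem exists_independent_of_card_filter {α : Type*} [LinearOrder α] (t n M₁ M₂ : ℕ)
    (A : Finset α) (u : α) (hu : u ∉ A) (H : Finset (Finset α))
    (hunif : ∀ e ∈ H, #e = t + 5)
    (hH : ∀ S : Finset α, #S = t + 6 → #{e ∈ H | e ⊆ S} ≠ 1 ∧ #{e ∈ H | e ⊆ S} ≤ 4)
    (hM₁ : (n ^ t + 2) ^ (n + n ^ t) ≤ M₁) (hM₂ : (2 * 2 ^ M₁ ^ (t + 1)) ^ M₁ ≤ M₂)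
    (hA : (2 * 2 ^ M₂ ^ (t + 2)) ^ M₂ ≤ #A) :
    ∃ I : Finset α, #I = n ∧ ∀ e ∈ H, ¬ e ⊆ I := by
  classical
  obtain ⟨B, z, hBA, hzA, hBc, hBz, hB⟩ :=
    exists_end_homogeneous (fun S => insert u S ∈ H) (t + 2) M₂ A hA
  obtain ⟨C, y, hCB, hyB, hCc, hCy, hC⟩ :=
    exists_end_homogeneous (fun S => insert u (insert z S) ∈ H) (t + 1) M₁ B (by rwa [hBc])
  have hCu : ∀ x ∈ C, x ≠ u := fun x hx h => hu (h ▸ hBA (hCB hx))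
  have hyu : y ≠ u := fun h => hu (h ▸ hBA hyB)
  have hzu : z ≠ u := fun h => hu (h ▸ hzA)
  have hyz := hBz y hyB
  have hCz : ∀ x ∈ C, x < z := fun x hx => hBz x (hCB hx)
  obtain ⟨I, hIC, hIc, hI⟩ := exists_independent
    (fun S => insert u (insert z (insert y S)) ∈ H) t n C
    (by
      intro T hT hTc v hv w hw a ha hTv hvw hwa h₁ h₂ h₃
      have hTw : ∀ x ∈ T, x < w := fun x hx => (hTv x hx).trans hvw
      have hTa : ∀ x ∈ T, x < a := fun x hx => (hTw x hx).trans hwa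
      have hvT : v ∉ T := fun h => lt_irrefl _ (hTv v h)
      have hwT : w ∉ T := fun h => lt_irrefl _ (hTw w h)
      have haT : a ∉ T := fun h => lt_irrefl _ (hTa a h)
      have hyT : y ∉ T := fun h => lt_irrefl _ (hCy y (hT h))
      have hzT : z ∉ T := fun h => lt_irrefl _ (hCz z (hT h))
      have huT : u ∉ T := fun h => hCu u (hT h) rfl
      have hvy := hCy v hv
      have hwy := hCy w hw
      have hay := hCy a ha
      have hvz := hCz v hv
      have hwz := hCz w hw
      have haz := hCz a ha
      have hvu := hCu v hv
      have hwu := hCu w hw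
      have hau := hCu a ha
      have hva := hvw.trans hwa
      have hwvT : insert w (insert v T) ⊆ C := insert_subset hw (insert_subset hv hT)
      have hwvTc : #(insert w (insert v T)) = t + 2 := by
        rw [card_insert_of_notMem (by simp [hwT, hvw.ne']), card_insert_of_notMem hvT, hTc]
      have hlta : ∀ x ∈ insert w (insert v T), x < a := by
        simp only [mem_insert]
        rintro x (rfl | rfl | hx)
        exacts [hwa, hva, hTa x hx]
      have h₄ := (hC _ hwvT hwvTc a ha hlta).2 h₁
      have h₅ := (hB (insert a (insert w (insert v T)))
        ((insert_subset ha hwvT).trans hCB)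
        (by rw [card_insert_of_notMem fun h => lt_irrefl _ (hlta a h), hwvTc])
        y hyB fun x hx => hCy x (insert_subset ha hwvT hx)).2 h₄
      set S := insert u (insert z (insert y (insert a (insert w (insert v T))))) with hS
      have hSc : #S = t + 6 := by
        rw [hS, card_insert_of_notMem, card_insert_of_notMem, card_insert_of_notMem,
          card_insert_of_notMem fun h => lt_irrefl _ (hlta a h), hwvTc]
        all_goals
          simp only [mem_insert, not_or]
          grind
      have hsub : ({v, w, a, y, z} : Finset α).image S.erase ⊆ {e ∈ H | e ⊆ S} := by
        intro e he
        simp only [mem_image, mem_insert, mem_singleton] at he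
        obtain ⟨x, hx, rfl⟩ := he
        refine mem_filter.2 ⟨?_, erase_subset _ _⟩
        rcases hx with rfl | rfl | rfl | rfl | rfl
        · convert h₃ using 1
          ext b
          simp only [hS, mem_erase, mem_insert]
          grind
        · convert h₂ using 1
          ext b
          simp only [hS, mem_erase, mem_insert]
          grind
        · convert h₁ using 1
          ext b
          simp only [hS, mem_erase, mem_insert]
          grind
        · convert h₄ using 1
          ext b
          simp only [hS, mem_erase, mem_insert]
          grind
        · convert h₅ using 1
          ext b
          simp only [hS, mem_erase, mem_insert]
          grind
      have h5 : #(({v, w, a, y, z} : Finset α).image S.erase) = 5 := by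
        rw [card_image_of_injOn]
        · rw [card_insert_of_notMem, card_insert_of_notMem, card_insert_of_notMem,
            card_insert_of_notMem, card_singleton]
          all_goals
            simp [hvw.ne, hva.ne, hwa.ne, hvy.ne, hwy.ne, hay.ne, hvz.ne, hwz.ne, haz.ne, hyz.ne]
        · refine (erase_injOn S).mono ?_
          intro x hx
          simp only [coe_insert, coe_singleton, Set.mem_insert_iff, Set.mem_singleton_iff] at hx
          simp only [hS, mem_coe, mem_insert]
          grind
      have := card_le_card hsub
      have := (hH S hSc).2
      omega)
    (by rwa [hCc])
  have hI₁ := forall_not_of_end_homogeneous (P := fun S => insert u (insert z S) ∈ H) hIC hC hI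
  have hI₂ := forall_not_of_end_homogeneous (P := fun S => insert u S ∈ H) (hIC.trans hCB) hB hI₁
  refine ⟨I, hIc, fun e he heI => ?_⟩
  have hue : u ∉ e := fun h => hCu u (hIC (heI h)) rfl
  have hSc : #(insert u e) = t + 6 := by rw [card_insert_of_notMem hue, hunif e he]
  have hmem : e ∈ ({f ∈ H | f ⊆ insert u e} : Finset (Finset α)) :=
    mem_filter.2 ⟨he, subset_insert _ _⟩
  have hgt : 1 < #{f ∈ H | f ⊆ insert u e} :=
    lt_of_le_of_ne (card_pos.2 ⟨e, hmem⟩) (hH _ hSc).1.symm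
  obtain ⟨f, hf, hfe⟩ := exists_mem_ne hgt e
  obtain ⟨hfH, hfS⟩ := mem_filter.1 hf
  by_cases huf : u ∈ f
  · refine hI₂ (f.erase u) ((subset_insert_iff.1 hfS).trans heI)
      (by rw [card_erase_of_mem huf, hunif f hfH]; omega) ?_
    simpa only [insert_erase huf] using hfH
  · exact hfe (eq_of_subset_of_card_le ((subset_insert_iff_of_notMem huf).1 hfS)
      (by rw [hunif e he, hunif f hfH]))

theorem two_mul_two_pow_pow_le (s M : ℕ) (hM : 2 ≤ M) :
    (2 * 2 ^ M ^ s) ^ M ≤ 2 ^ M ^ (s + 2) := by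
  rw [← pow_succ', ← pow_mul]
  refine Nat.pow_le_pow_right two_pos ?_
  have : 1 ≤ M ^ s := Nat.one_le_pow _ _ (by omega)
  calc (M ^ s + 1) * M ≤ (M ^ s * M) * M := by gcongr; nlinarith
    _ = M ^ (s + 2) := by ring

theorem tower_bound (t M : ℕ) (hM : 2 ≤ M) :
    (2 * 2 ^ (2 ^ M ^ (t + 3)) ^ (t + 2)) ^ (2 ^ M ^ (t + 3)) + 1 ≤ 2 ^ 2 ^ M ^ (2 * t + 8) := by
  have hK : 2 ≤ 2 ^ M ^ (t + 3) := le_self_pow₀ one_le_two (by positivity)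
  have h1 := two_mul_two_pow_pow_le (t + 2) _ hK
  have h2 : t + 5 ≤ M ^ (t + 5) :=
    Nat.lt_two_pow_self.le.trans (Nat.pow_le_pow_left hM _)
  set K := 2 ^ M ^ (t + 3) with hKdef
  calc (2 * 2 ^ K ^ (t + 2)) ^ K + 1 ≤ 2 ^ K ^ (t + 4) + 2 ^ K ^ (t + 4) :=
        Nat.add_le_add h1 Nat.one_le_two_pow
    _ = 2 ^ (K ^ (t + 4) + 1) := by ring
    _ ≤ 2 ^ K ^ (t + 5) := by
        refine Nat.pow_le_pow_right two_pos ?_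
        have : 1 ≤ K ^ (t + 4) := Nat.one_le_pow _ _ (by omega)
        rw [pow_succ K (t + 4)]
        nlinarith
    _ ≤ 2 ^ 2 ^ M ^ (2 * t + 8) := by
        rw [hKdef, ← pow_mul]
        refine Nat.pow_le_pow_right two_pos (Nat.pow_le_pow_right two_pos ?_)
        calc M ^ (t + 3) * (t + 5) ≤ M ^ (t + 3) * M ^ (t + 5) := by gcongr
          _ = M ^ (2 * t + 8) := by ring

theorem base_bound (t n : ℕ) (hn : 3 ≤ n) :
    (n ^ t + 2) ^ (n + n ^ t) ≤ n ^ ((t + 1) * 2 * n ^ (t + 1)) := by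
  have h1 : 1 ≤ n ^ t := Nat.one_le_pow _ _ (by omega)
  have h2 : n ^ t + 2 ≤ n ^ (t + 1) := by rw [pow_succ]; nlinarith
  have h3 : n + n ^ t ≤ 2 * n ^ (t + 1) := by rw [pow_succ]; nlinarith
  calc (n ^ t + 2) ^ (n + n ^ t) ≤ (n ^ (t + 1)) ^ (n + n ^ t) := Nat.pow_le_pow_left h2 _
    _ ≤ (n ^ (t + 1)) ^ (2 * n ^ (t + 1)) := Nat.pow_le_pow_right (by positivity) h3
    _ = n ^ ((t + 1) * 2 * n ^ (t + 1)) := by rw [← pow_mul]; ring_nf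


/-- For every integer `k ≥ 5` there exists `c' > 0` such that for every
`n ≥ k`, every `k`-uniform hypergraph on at least `2 ^ 2 ^ 2 ^ (c' * n ^ (k-4) * log n)`
vertices in which every set of `k + 1` vertices induces exactly 0, 2, or 4 edges contains
an independent set of size `n`. -/
theorem g_upper_bound (k : ℕ) (hk : 5 ≤ k) :
    ∃ c' : ℝ, 0 < c' ∧ ∀ n : ℕ, k ≤ n →
      ∀ N : ℕ,
        (N : ℝ) ≥ (2 : ℝ) ^ ((2 : ℝ) ^ ((2 : ℝ) ^ (c' * (n : ℝ) ^ (k - 4) * Real.log n))) →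
        ∀ H : Finset (Finset (Fin N)),
          (∀ e ∈ H, e.card = k) →
          (∀ S : Finset (Fin N), S.card = k + 1 →
            (H.filter (· ⊆ S)).card ∈ ({0, 2, 4} : Set ℕ)) →
          ∃ I : Finset (Fin N), I.card = n ∧ ∀ e ∈ H, ¬ e ⊆ I := by
  obtain ⟨t, rfl⟩ := Nat.exists_eq_add_of_le' hk
  have hlog2 : 0 < Real.log 2 := Real.log_pos one_lt_two
  refine ⟨((t + 1) * 2 * (2 * t + 8) : ℕ) / Real.log 2, by positivity, ?_⟩
  intro n hn N hN H hunif hH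
  set M := n ^ ((t + 1) * 2 * n ^ (t + 1)) with hMdef
  have hM : 2 ≤ M := (show 2 ≤ n by omega).trans (Nat.le_self_pow
    (Nat.mul_ne_zero (by omega) (pow_ne_zero _ (by omega))) _)
  have hexp : (2 : ℝ) ^ (((t + 1) * 2 * (2 * t + 8) : ℕ) / Real.log 2 *
      (n : ℝ) ^ (t + 5 - 4) * Real.log n) = ((M ^ (2 * t + 8) : ℕ) : ℝ) := by
    have hn0 : (0 : ℝ) < n := by exact_mod_cast (by omega : 0 < n)
    rw [Real.rpow_def_of_pos two_pos, show t + 5 - 4 = t + 1 by omega, hMdef, ← pow_mul,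
      Nat.cast_pow, ← Real.exp_log (pow_pos hn0 ((t + 1) * 2 * n ^ (t + 1) * (2 * t + 8))),
      Real.log_pow]
    congr 1
    push_cast
    field_simp
  have hN' : 2 ^ 2 ^ M ^ (2 * t + 8) ≤ N := by
    rw [hexp, Real.rpow_natCast] at hN
    have h2 : (2 : ℝ) ^ M ^ (2 * t + 8) = ((2 ^ M ^ (2 * t + 8) : ℕ) : ℝ) := by push_cast; rfl
    rw [h2, Real.rpow_natCast] at hN
    exact_mod_cast hN
  have hbound := (tower_bound t M hM).trans hN'
  have hNpos : 0 < N := by omega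
  refine exists_independent_of_card_filter t n M (2 ^ M ^ (t + 3))
    (Finset.univ.erase ⟨0, hNpos⟩) ⟨0, hNpos⟩ (Finset.notMem_erase _ _) H hunif ?_
    (base_bound t n (by omega)) (two_mul_two_pow_pow_le (t + 1) M hM) ?_
  · intro S hS
    have := hH S hS
    simp only [Set.mem_insert_iff, Set.mem_singleton_iff] at this
    omega
  · rw [Finset.card_erase_of_mem (Finset.mem_univ _), Finset.card_univ, Fintype.card_fin]
    omega
end

section
/- Fix integers k ≥ 5 and N ≥ k+1, and let φ be any function from the (k−3)-element subsets of [N] = {1, …, N} to the 2-element subsets of [k−1]. Define the k-uniform hypergraph H_φ on [N] whose edges are the k-element subsets e of [N] with |G_φ[e]| odd. Then for every (k+1)-element subset S of [N], the number of edges of H_φ contained in S is exactly 0, 2, or 4. -/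
/-- The (1-indexed) position of `u` in the increasing enumeration of the finite set `f`:
if `f = {v_1 < v_2 < ⋯ < v_m}` and `u = v_i`, then `rankIn f u = i`. -/
def rankIn {N : ℕ} (f : Finset (Fin N)) (u : Fin N) : ℕ :=
  (f.filter (· ≤ u)).card

/-- The `(k-1)`-uniform hypergraph `G_φ` on `[N]`: a `(k-1)`-element set
`f = {v_1 < ⋯ < v_{k-1}}` is an edge iff `φ (f \ {v_i, v_j}) = {i, j}` for all `i < j`,
i.e. iff `φ (f \ {u, v}) = χ_f (f \ {u, v})` for every pair `{u, v} ⊆ f`. -/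
def Gphi (k N : ℕ) (φ : Finset (Fin N) → Finset ℕ) : Finset (Finset (Fin N)) :=
  (Finset.univ.powersetCard (k - 1)).filter
    (fun f => ∀ u ∈ f, ∀ v ∈ f, u ≠ v →
      φ (f \ {u, v}) = {rankIn f u, rankIn f v})

/-- The `k`-uniform hypergraph `H_φ` on `[N]`, whose edges are the `k`-element subsets `e`
of `[N]` with `|G_φ[e]|` odd. -/
def Hphi (k N : ℕ) (φ : Finset (Fin N) → Finset ℕ) : Finset (Finset (Fin N)) :=
  (Finset.univ.powersetCard k).filter
    (fun e => Odd (((Gphi k N φ).filter (· ⊆ e)).card))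

namespace SimpleGraph

variable {V : Type*} [Fintype V] [DecidableEq V] (G : SimpleGraph V) [DecidableRel G.Adj]

/-- In a graph of maximum degree at most `2` without three pairwise disjoint edges, at most four
vertices have odd degree. -/
theorem card_odd_degree_le_four (hdeg : ∀ v, G.degree v ≤ 2)
    (hmatch : ∀ a b c d e f, G.Adj a b → G.Adj c d → G.Adj e f →
      a ≠ c → a ≠ d → b ≠ c → b ≠ d → a ≠ e → a ≠ f → b ≠ e → b ≠ f →
      c ≠ e → c ≠ f → d ≠ e → d ≠ f → False) :
    (Finset.univ.filter fun v => Odd (G.degree v)).card ≤ 4 := by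
  set L := Finset.univ.filter fun v => Odd (G.degree v) with hL
  have hleaf : ∀ v, ∃ w, v ∈ L → G.neighborFinset v = {w} := by
    intro v
    by_cases hv : v ∈ L
    · have h1 : G.degree v = 1 := by
        have := hdeg v
        obtain ⟨m, hm⟩ := (Finset.mem_filter.1 hv).2
        omega
      obtain ⟨w, hw⟩ := Finset.card_eq_one.1 h1
      exact ⟨w, fun _ => hw⟩
    · exact ⟨v, fun h => absurd h hv⟩
  choose p hp using hleaf
  have hadj : ∀ v ∈ L, ∀ w, G.Adj v w ↔ w = p v := by
    intro v hv w
    rw [← mem_neighborFinset, hp v hv, Finset.mem_singleton]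
  have hD : ∀ v ∈ L, (L.filter fun w => w = v ∨ w = p v ∨ p w = p v).card ≤ 2 := by
    intro v hv
    have hvp : G.Adj v (p v) := (hadj v hv _).2 rfl
    by_cases hpv : p v ∈ L
    · refine (Finset.card_le_card (t := {v, p v}) ?_).trans Finset.card_le_two
      intro w hw
      obtain ⟨hwL, rfl | rfl | h⟩ := Finset.mem_filter.1 hw
      · simp
      · simp
      · have hwp : G.Adj w (p v) := (hadj w hwL _).2 h.symm
        rw [(hadj _ hpv w).1 hwp.symm, ← (hadj _ hpv v).1 hvp.symm]
        simp
    · refine (Finset.card_le_card (t := G.neighborFinset (p v)) ?_).trans (hdeg _)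
      intro w hw
      rw [mem_neighborFinset]
      obtain ⟨hwL, rfl | rfl | h⟩ := Finset.mem_filter.1 hw
      · exact hvp.symm
      · exact absurd hwL hpv
      · exact ((hadj w hwL _).2 h.symm).symm
  have hdisj : ∀ v ∈ L, ∀ w ∈ L, w ∉ L.filter (fun w => w = v ∨ w = p v ∨ p w = p v) →
      v ≠ w ∧ v ≠ p w ∧ p v ≠ w ∧ p v ≠ p w := by
    intro v hv w hw h
    simp only [Finset.mem_filter, hw, true_and, not_or] at h
    refine ⟨Ne.symm h.1, fun h' => h.2.1 ?_, Ne.symm h.2.1, Ne.symm h.2.2⟩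
    exact (hadj v hv w).1 ((hadj w hw v).2 h').symm
  by_contra! hcard
  obtain ⟨u, hu⟩ := Finset.card_pos.1 (by omega : 0 < L.card)
  obtain ⟨v, hv, hvu⟩ := Finset.exists_mem_notMem_of_card_lt_card
    (lt_of_le_of_lt (hD u hu) (by omega : 2 < L.card))
  obtain ⟨w, hw, hwuv⟩ := Finset.exists_mem_notMem_of_card_lt_card
    (lt_of_le_of_lt ((Finset.card_union_le _ _).trans (Nat.add_le_add (hD u hu) (hD v hv)))
      (by omega : 2 + 2 < L.card))
  rw [Finset.mem_union, not_or] at hwuv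
  obtain ⟨h1, h2, h3, h4⟩ := hdisj u hu v hv hvu
  obtain ⟨h5, h6, h7, h8⟩ := hdisj u hu w hw hwuv.1
  obtain ⟨h9, h10, h11, h12⟩ := hdisj v hv w hw hwuv.2
  exact hmatch u (p u) v (p v) w (p w) ((hadj u hu _).2 rfl) ((hadj v hv _).2 rfl)
    ((hadj w hw _).2 rfl) h1 h2 h3 h4 h5 h6 h7 h8 h9 h10 h11 h12

end SimpleGraph

theorem Finset.pair_eq_pair_cases {α : Type*} [DecidableEq α] {x y z w : α}
    (h : ({x, y} : Finset α) = {z, w}) : (x = z ∧ y = w) ∨ (x = w ∧ y = z) := by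
  have h' := congrArg (fun s : Finset α => (s : Set α)) h
  simpa [Set.pair_eq_pair_iff] using h'

theorem rankIn_lt_rankIn {N : ℕ} {S : Finset (Fin N)} {a b : Fin N} (hb : b ∈ S) (h : a < b) :
    rankIn S a < rankIn S b := by
  refine Finset.card_lt_card (Finset.ssubset_iff_of_subset ?_ |>.2 ⟨b, ?_, ?_⟩)
  · intro x hx
    rw [Finset.mem_filter] at hx ⊢
    exact ⟨hx.1, hx.2.trans h.le⟩
  · simp [hb]
  · simp [h]

theorem rankIn_le_rankIn_iff {N : ℕ} {S : Finset (Fin N)} {a b : Fin N} (ha : a ∈ S) :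
    rankIn S a ≤ rankIn S b ↔ a ≤ b := by
  refine ⟨fun h => ?_, fun h => ?_⟩
  · by_contra! hlt
    exact absurd (rankIn_lt_rankIn ha hlt) (not_lt.2 h)
  · refine Finset.card_le_card fun x hx => ?_
    rw [Finset.mem_filter] at hx ⊢
    exact ⟨hx.1, hx.2.trans h⟩

theorem rankIn_ne {N : ℕ} {S : Finset (Fin N)} {a b : Fin N} (ha : a ∈ S) (hb : b ∈ S)
    (h : a ≠ b) : rankIn S a ≠ rankIn S b := by
  rcases lt_or_gt_of_ne h with h | h
  · exact (rankIn_lt_rankIn hb h).ne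
  · exact (rankIn_lt_rankIn ha h).ne'

/-- The effect on ranks of deleting two elements. -/
theorem rankIn_sdiff_pair {N : ℕ} {S : Finset (Fin N)} {a b : Fin N} (ha : a ∈ S) (hb : b ∈ S)
    (hab : a ≠ b) (c : Fin N) :
    rankIn (S \ {a, b}) c + ((if rankIn S a ≤ rankIn S c then 1 else 0) +
      (if rankIn S b ≤ rankIn S c then 1 else 0)) = rankIn S c := by
  simp only [rankIn_le_rankIn_iff ha, rankIn_le_rankIn_iff hb]
  have h : (S.filter (· ≤ c)) \ (({a, b} : Finset (Fin N)).filter (· ≤ c)) =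
      (S \ {a, b}).filter (· ≤ c) := by
    ext x
    simp only [Finset.mem_sdiff, Finset.mem_filter]
    tauto
  have hsub : ({a, b} : Finset (Fin N)).filter (· ≤ c) ⊆ S.filter (· ≤ c) := by
    refine Finset.filter_subset_filter _ ?_
    simp [Finset.insert_subset_iff, ha, hb]
  have hcard : (({a, b} : Finset (Fin N)).filter (· ≤ c)).card =
      (if a ≤ c then 1 else 0) + (if b ≤ c then 1 else 0) := by
    rw [Finset.card_filter, Finset.sum_pair hab]
  rw [← hcard, rankIn, ← h]
  exact Finset.card_sdiff_add_card_eq_card hsub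

/-- The graph on `[N]` joining two elements of `S` when deleting both from `S` leaves an edge of
`G_φ`. -/
def deletionGraph (k N : ℕ) (φ : Finset (Fin N) → Finset ℕ) (S : Finset (Fin N)) :
    SimpleGraph (Fin N) where
  Adj a b := a ≠ b ∧ a ∈ S ∧ b ∈ S ∧ S \ {a, b} ∈ Gphi k N φ
  symm := ⟨by
    rintro a b ⟨h1, h2, h3, h4⟩
    exact ⟨h1.symm, h3, h2, by rwa [Finset.pair_comm]⟩⟩
  loopless := ⟨fun _ h => h.1 rfl⟩

section deletionGraph

variable {k N : ℕ} {φ : Finset (Fin N) → Finset ℕ} {S : Finset (Fin N)}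

instance : DecidableRel (deletionGraph k N φ S).Adj := fun a b =>
  inferInstanceAs (Decidable (a ≠ b ∧ a ∈ S ∧ b ∈ S ∧ S \ {a, b} ∈ Gphi k N φ))

theorem deletionGraph_adj {a b : Fin N} : (deletionGraph k N φ S).Adj a b ↔
    a ≠ b ∧ a ∈ S ∧ b ∈ S ∧ S \ {a, b} ∈ Gphi k N φ := Iff.rfl

theorem phi_sdiff_of_deletionGraph_adj {a b u v : Fin N} (h : (deletionGraph k N φ S).Adj a b)
    (hu : u ∈ S) (hv : v ∈ S) (huv : u ≠ v) (hua : u ≠ a) (hub : u ≠ b) (hva : v ≠ a)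
    (hvb : v ≠ b) :
    φ (S \ {a, b, u, v}) = {rankIn (S \ {a, b}) u, rankIn (S \ {a, b}) v} := by
  rw [deletionGraph_adj, Gphi, Finset.mem_filter] at h
  rw [← h.2.2.2.2 u (by simp [*]) v (by simp [*]) huv]
  congr 1
  ext x
  simp only [Finset.mem_sdiff, Finset.mem_insert, Finset.mem_singleton]
  tauto

/-- Two neighbours of the same vertex `a` are consecutive in `S \ {a}`. -/
theorem rankIn_eq_of_common_neighbor (hS : 5 ≤ S.card) {a b c : Fin N}
    (hab : (deletionGraph k N φ S).Adj a b) (hac : (deletionGraph k N φ S).Adj a c)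
    (hbc : b < c) :
    rankIn S c = rankIn S b + 1 ∨
      (rankIn S a = rankIn S b + 1 ∧ rankIn S c = rankIn S b + 2) := by
  have hcard : 1 < (S \ {a, b, c}).card := by
    have h1 := Finset.le_card_sdiff {a, b, c} S
    have h2 := Finset.card_le_three (a := a) (b := b) (c := c)
    omega
  obtain ⟨d, hd, e, he, hde⟩ := Finset.one_lt_card.1 hcard
  simp only [Finset.mem_sdiff, Finset.mem_insert, Finset.mem_singleton, not_or] at hd he
  obtain ⟨hab', ha, hb, -⟩ := deletionGraph_adj.1 hab
  obtain ⟨hac', -, hc, -⟩ := deletionGraph_adj.1 hac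
  have r1 := rankIn_sdiff_pair ha hb hab' c
  have r2 := rankIn_sdiff_pair ha hc hac' b
  have n1 := rankIn_ne ha hb hab'
  have n2 := rankIn_ne ha hc hac'
  have n3 := rankIn_lt_rankIn hc hbc
  have key : ∀ x ∈ S, x ≠ a → x ≠ b → x ≠ c →
      (rankIn S c = rankIn S b + 1 ∨
        (rankIn S a = rankIn S b + 1 ∧ rankIn S c = rankIn S b + 2)) ∨
      (rankIn S c = rankIn S x + 1 ∨
        (rankIn S a = rankIn S x + 1 ∧ rankIn S c = rankIn S x + 2)) := by
    intro x hx hxa hxb hxc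
    have h1 := phi_sdiff_of_deletionGraph_adj hab hc hx (Ne.symm hxc) hac'.symm hbc.ne' hxa hxb
    have h2 := phi_sdiff_of_deletionGraph_adj hac hb hx (Ne.symm hxb) hab'.symm hbc.ne hxa hxc
    have hset : ({a, b, c, x} : Finset (Fin N)) = {a, c, b, x} := by
      rw [Finset.insert_comm b c]
    rw [hset, h2] at h1
    have h := Finset.pair_eq_pair_cases h1
    have r3 := rankIn_sdiff_pair ha hb hab' x
    have r4 := rankIn_sdiff_pair ha hc hac' x
    have n4 := rankIn_ne hx ha hxa
    have n5 := rankIn_ne hx hb hxb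
    have n6 := rankIn_ne hx hc hxc
    clear h1 h2 hset
    split_ifs at r1 r2 r3 r4 <;> omega
  have kd := key d hd.1 hd.2.1 hd.2.2.1 hd.2.2.2
  have ke := key e he.1 he.2.1 he.2.2.1 he.2.2.2
  have n4 := rankIn_ne hd.1 ha hd.2.1
  have n5 := rankIn_ne he.1 ha he.2.1
  have n6 := rankIn_ne hd.1 he.1 hde
  clear r1 r2
  omega

theorem deletionGraph_degree_le_two (hS : 5 ≤ S.card) (a : Fin N) :
    (deletionGraph k N φ S).degree a ≤ 2 := by
  by_contra! h
  obtain ⟨x, hx, y, hy, z, hz, hxy, hxz, hyz⟩ := Finset.two_lt_card.1 h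
  rw [SimpleGraph.mem_neighborFinset] at hx hy hz
  have key : ∀ u v, (deletionGraph k N φ S).Adj a u → (deletionGraph k N φ S).Adj a v → u ≠ v →
      _ := fun u v hu hv huv =>
    (lt_or_gt_of_ne huv).imp (rankIn_eq_of_common_neighbor hS hu hv)
      (rankIn_eq_of_common_neighbor hS hv hu)
  have h1 := key x y hx hy hxy
  have h2 := key x z hx hz hxz
  have h3 := key y z hy hz hyz
  have n1 := rankIn_ne hx.2.1 hx.2.2.1 hx.1
  have n2 := rankIn_ne hx.2.1 hy.2.2.1 hy.1
  have n3 := rankIn_ne hx.2.1 hz.2.2.1 hz.1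
  omega

theorem rankIn_eq_of_disjoint_adj {a b c d : Fin N}
    (hab : (deletionGraph k N φ S).Adj a b) (hcd : (deletionGraph k N φ S).Adj c d)
    (hlt : a < b) (hlt' : c < d) (hac : a ≠ c) (had : a ≠ d) (hbc : b ≠ c) (hbd : b ≠ d) :
    (rankIn S c = rankIn S a + 1 ∨ (rankIn S c = rankIn S a + 2 ∧ rankIn S b = rankIn S a + 1)) ∨
    (rankIn S a = rankIn S c + 1 ∨
      (rankIn S a = rankIn S c + 2 ∧ rankIn S d = rankIn S c + 1)) := by
  obtain ⟨hab', ha, hb, -⟩ := deletionGraph_adj.1 hab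
  obtain ⟨hcd', hc, hd, -⟩ := deletionGraph_adj.1 hcd
  have h1 := phi_sdiff_of_deletionGraph_adj hab hc hd hcd' hac.symm hbc.symm had.symm hbd.symm
  have h2 := phi_sdiff_of_deletionGraph_adj hcd ha hb hab' hac had hbc hbd
  have hset : ({a, b, c, d} : Finset (Fin N)) = {c, d, a, b} := by
    ext x
    simp only [Finset.mem_insert, Finset.mem_singleton]
    tauto
  rw [hset, h2] at h1
  have h := Finset.pair_eq_pair_cases h1
  have r1 := rankIn_sdiff_pair ha hb hab' c
  have r2 := rankIn_sdiff_pair ha hb hab' d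
  have r3 := rankIn_sdiff_pair hc hd hcd' a
  have r4 := rankIn_sdiff_pair hc hd hcd' b
  have n1 := rankIn_lt_rankIn hb hlt
  have n2 := rankIn_lt_rankIn hd hlt'
  have n3 := rankIn_ne ha hc hac
  have n4 := rankIn_ne ha hd had
  have n5 := rankIn_ne hb hc hbc
  have n6 := rankIn_ne hb hd hbd
  split_ifs at * <;> omega

theorem deletionGraph_no_three_disjoint_adj (a b c d e f : Fin N)
    (hab : (deletionGraph k N φ S).Adj a b) (hcd : (deletionGraph k N φ S).Adj c d)
    (hef : (deletionGraph k N φ S).Adj e f)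
    (hac : a ≠ c) (had : a ≠ d) (hbc : b ≠ c) (hbd : b ≠ d)
    (hae : a ≠ e) (haf : a ≠ f) (hbe : b ≠ e) (hbf : b ≠ f)
    (hce : c ≠ e) (hcf : c ≠ f) (hde : d ≠ e) (hdf : d ≠ f) : False := by
  wlog h1 : a < b generalizing a b
  · exact this b a hab.symm hbc hbd hac had hbe hbf hae haf (lt_of_le_of_ne (not_lt.1 h1) hab.ne')
  wlog h2 : c < d generalizing c d
  · exact this d c hcd.symm hde hdf hce hcf had hac hbd hbc (lt_of_le_of_ne (not_lt.1 h2) hcd.ne')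
  wlog h3 : e < f generalizing e f
  · exact this f e hef.symm haf hae hbf hbe hcf hce hdf hde (lt_of_le_of_ne (not_lt.1 h3) hef.ne')
  have k1 := rankIn_eq_of_disjoint_adj hab hcd h1 h2 hac had hbc hbd
  have k2 := rankIn_eq_of_disjoint_adj hab hef h1 h3 hae haf hbe hbf
  have k3 := rankIn_eq_of_disjoint_adj hcd hef h2 h3 hce hcf hde hdf
  have ha := hab.2.1
  have hb := hab.2.2.1
  have hc := hcd.2.1
  have hd := hcd.2.2.1
  have he := hef.2.1
  have hf := hef.2.2.1
  have n1 := rankIn_ne ha hc hac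
  have n2 := rankIn_ne ha hd had
  have n3 := rankIn_ne hb hc hbc
  have n5 := rankIn_ne ha he hae
  have n6 := rankIn_ne ha hf haf
  have n7 := rankIn_ne hb he hbe
  have n9 := rankIn_ne hc he hce
  have n10 := rankIn_ne hc hf hcf
  have n11 := rankIn_ne hd he hde
  omega

/-- The degree of `a` counts the edges of `G_φ` inside `S \ {a}`. -/
theorem deletionGraph_degree (hk : 1 ≤ k) (hS : S.card = k + 1) {a : Fin N} (ha : a ∈ S) :
    (deletionGraph k N φ S).degree a = ((Gphi k N φ).filter (· ⊆ S.erase a)).card := by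
  refine Finset.card_bij (fun b _ => S \ {a, b}) ?_ ?_ ?_
  · intro b hb
    rw [SimpleGraph.mem_neighborFinset] at hb
    refine Finset.mem_filter.2 ⟨hb.2.2.2, fun x hx => ?_⟩
    simp only [Finset.mem_sdiff, Finset.mem_insert, Finset.mem_singleton, not_or] at hx
    simp [hx]
  · intro b hb c hc h
    rw [SimpleGraph.mem_neighborFinset] at hb hc
    by_contra hbc
    have : b ∈ S \ {a, c} := by simp [hb.2.2.1, hb.1.symm, hbc]
    rw [← h] at this
    simp at this
  · intro f hf
    obtain ⟨hfG, hfS⟩ := Finset.mem_filter.1 hf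
    have hfc : f.card = k - 1 :=
      (Finset.mem_powersetCard.1 (Finset.mem_filter.1 hfG).1).2
    have h1 : (S.erase a \ f).card = 1 := by
      rw [Finset.card_sdiff_of_subset hfS, Finset.card_erase_of_mem ha]
      omega
    obtain ⟨b, hb⟩ := Finset.card_eq_one.1 h1
    have hb' : b ∈ S.erase a \ f := by simp [hb]
    simp only [Finset.mem_sdiff, Finset.mem_erase] at hb'
    have hfe : S \ {a, b} = f := by
      rw [← Finset.sdiff_sdiff_eq_self hfS, hb]
      ext x
      simp only [Finset.mem_sdiff, Finset.mem_insert, Finset.mem_singleton, Finset.mem_erase]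
      tauto
    refine ⟨b, ?_, hfe⟩
    rw [SimpleGraph.mem_neighborFinset, deletionGraph_adj, hfe]
    exact ⟨Ne.symm hb'.1.1, ha, hb'.1.2, hfG⟩

/-- The edges of `H_φ` inside `S` correspond to the vertices of odd degree. -/
theorem card_filter_Hphi_eq (hk : 1 ≤ k) (hS : S.card = k + 1) :
    (Finset.univ.filter fun a => Odd ((deletionGraph k N φ S).degree a)).card =
      ((Hphi k N φ).filter (· ⊆ S)).card := by
  have hmem : ∀ a, Odd ((deletionGraph k N φ S).degree a) → a ∈ S := by
    intro a h
    obtain ⟨b, hb⟩ := Finset.card_pos.1 h.pos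
    rw [SimpleGraph.mem_neighborFinset] at hb
    exact hb.2.1
  refine Finset.card_bij (fun a _ => S.erase a) ?_ ?_ ?_
  · intro a h
    replace h := (Finset.mem_filter.1 h).2
    have ha := hmem a h
    rw [deletionGraph_degree hk hS ha] at h
    refine Finset.mem_filter.2 ⟨Finset.mem_filter.2
      ⟨Finset.mem_powersetCard.2 ⟨Finset.subset_univ _, ?_⟩, h⟩, Finset.erase_subset _ _⟩
    rw [Finset.card_erase_of_mem ha, hS]
    rfl
  · intro a h b _ hab
    replace h := (Finset.mem_filter.1 h).2
    exact (Finset.erase_inj S (hmem a h)).1 hab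
  · intro e he
    obtain ⟨heH, heS⟩ := Finset.mem_filter.1 he
    obtain ⟨hec, hodd⟩ := Finset.mem_filter.1 heH
    have hec' := (Finset.mem_powersetCard.1 hec).2
    have h1 : (S \ e).card = 1 := by
      rw [Finset.card_sdiff_of_subset heS]
      omega
    obtain ⟨a, ha⟩ := Finset.card_eq_one.1 h1
    have haS : a ∈ S := (Finset.mem_sdiff.1 (ha ▸ Finset.mem_singleton_self a : a ∈ S \ e)).1
    have hee : S.erase a = e := by
      rw [← Finset.sdiff_sdiff_eq_self heS, ha, Finset.sdiff_singleton_eq_erase]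
    refine ⟨a, Finset.mem_filter.2 ⟨Finset.mem_univ _, ?_⟩, hee⟩
    rwa [deletionGraph_degree hk hS haS, hee]

end deletionGraph

/-- For `k ≥ 5`, `N ≥ k + 1` and any `φ` from `(k-3)`-subsets of `[N]` to
`2`-element subsets of `[k-1]`, every `(k+1)`-element subset `S` of `[N]` contains exactly
0, 2, or 4 edges of `H_φ`. -/
theorem Hphi_induces_024 (k N : ℕ) (hk : 5 ≤ k) (hN : k + 1 ≤ N)
    (φ : Finset (Fin N) → Finset ℕ)
    (hφ : ∀ A : Finset (Fin N), A.card = k - 3 →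
      (φ A).card = 2 ∧ φ A ⊆ Finset.Icc 1 (k - 1))
    (S : Finset (Fin N)) (hS : S.card = k + 1) :
    ((Hphi k N φ).filter (· ⊆ S)).card ∈ ({0, 2, 4} : Set ℕ) := by
  have heven := (deletionGraph k N φ S).even_card_odd_degree_vertices
  have hle := (deletionGraph k N φ S).card_odd_degree_le_four
    (deletionGraph_degree_le_two (by omega)) deletionGraph_no_three_disjoint_adj
  rw [card_filter_Hphi_eq (by omega) hS] at heven hle
  obtain ⟨m, hm⟩ := heven
  simp only [Set.mem_insert_iff, Set.mem_singleton_iff]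
  omega
end
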